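/- arXiv:2602.01988 — 4 statements merged into one kernel-verified Lean document; each statement's English description precedes it below -/
import Mathlib

section
/- Let ε > 0 and let γ : [0,1] → ℝ be continuous on [0,1] and continuously differentiable on (0,1) with γ(t) > 0 for all t ∈ (0,1). Suppose the improper integral ∫₀¹ 1/γ(t) dt is finite and that the function t ↦ γ'(t)·γ(t), defined on (0,1), admits a continuous extension to [0,1]. Then there exists a strictly increasing, bijective, continuously differentiable time change θ : [0,1] → [0,1] with θ(0) = 0 and θ(1) = 1 such that the time-transformed coefficient ĉ(t) := (γ'(θ(t)) − ε/γ(θ(t)))·θ'(t), defined for t ∈ (0,1), admits a continuous extension to the compact interval [0,1]. Moreover, θ may be taken as the inverse of s(t) = (1/C)·∫₀ᵗ (ε/γ(σ)) dσ with C = ε·∫₀¹ (1/γ(σ)) dσ, in which case θ'(t) = (C/ε)·γ(θ(t)) and ĉ(t) = (C/ε)·γ'(θ(t))·γ(θ(t)) − C for all t ∈ (0,1). -/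
open Set Filter Topology MeasureTheory intervalIntegral

/-- The inverse of a continuous strictly increasing map between compact intervals, extended
continuously to the whole line. -/
theorem StrictMonoOn.exists_continuous_inverse_Icc {s : ℝ → ℝ} {a b : ℝ} (hab : a ≤ b)
    (hs : StrictMonoOn s (Icc a b)) (hc : ContinuousOn s (Icc a b)) :
    ∃ θ : ℝ → ℝ, Continuous θ ∧ (∀ t, θ t ∈ Icc a b) ∧
      (∀ t ∈ Icc (s a) (s b), s (θ t) = t) ∧ ∀ x ∈ Icc a b, θ (s x) = x := by
  have ha : a ∈ Icc a b := left_mem_Icc.2 hab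
  have hb : b ∈ Icc a b := right_mem_Icc.2 hab
  have hsab : s a ≤ s b := hs.monotoneOn ha hb hab
  have himage : s '' Icc a b = Icc (s a) (s b) :=
    (hs.monotoneOn.image_Icc_subset).antisymm (intermediate_value_Icc hab hc)
  let e : Icc a b ≃o Icc (s a) (s b) := (hs.orderIso s _).trans (OrderIso.setCongr _ _ himage)
  have he : ∀ x, (e x : ℝ) = s x := fun _ => rfl
  refine ⟨fun t => e.symm (projIcc _ _ hsab t),
    continuous_subtype_val.comp (e.symm.continuous.comp continuous_projIcc),
    fun t => (e.symm _).2, fun t ht => ?_, fun x hx => ?_⟩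
  · rw [← he, e.apply_symm_apply, projIcc_of_mem _ ht]
  · have hex : s x ∈ Icc (s a) (s b) := (e ⟨x, hx⟩).2
    have : projIcc _ _ hsab (s x) = e ⟨x, hx⟩ := by
      rw [projIcc_of_mem _ hex]; exact Subtype.ext rfl
    simp only [this, e.symm_apply_apply]

/-- A function that is continuous on `[a, b]` and has derivative `h` on `(a, b)`, with `h`
continuous on the line, is continuously differentiable on `[a, b]`. -/
theorem contDiffOn_one_Icc_of_hasDerivAt_Ioo {f h : ℝ → ℝ} {a b : ℝ}
    (hf : ContinuousOn f (Icc a b)) (hh : Continuous h)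
    (hderiv : ∀ t ∈ Ioo a b, HasDerivAt f (h t) t) : ContDiffOn ℝ 1 f (Icc a b) := by
  have hG : ContDiff ℝ 1 fun t => f a + ∫ u in a..t, h u := by
    have hd : ∀ t, HasDerivAt (fun t => f a + ∫ u in a..t, h u) (h t) t := fun t =>
      (hh.integral_hasStrictDerivAt a t).hasDerivAt.const_add _
    rw [contDiff_one_iff_deriv]
    exact ⟨fun t => (hd t).differentiableAt, by rwa [funext fun t => (hd t).deriv]⟩
  refine hG.contDiffOn.congr fun t ht => ?_
  rw [integral_eq_sub_of_hasDerivAt_of_le ht.1 (hf.mono (Icc_subset_Icc_right ht.2))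
    (fun x hx => hderiv x ⟨hx.1, hx.2.trans_le ht.2⟩) (hh.intervalIntegrable _ _)]
  ring

/-- The primitive of an integrable positive function is strictly increasing. -/
theorem strictMonoOn_primitive_of_pos {f : ℝ → ℝ} {a b : ℝ}
    (hf : IntervalIntegrable f volume a b) (hpos : ∀ t ∈ Ioo a b, 0 < f t) :
    StrictMonoOn (fun x => ∫ u in a..x, f u) (Icc a b) := by
  intro x hx y hy hxy
  have hab : a ≤ b := hx.1.trans hx.2
  have hsub : ∀ u ∈ Icc a b, ∀ v ∈ Icc a b, IntervalIntegrable f volume u v := fun u hu v hv =>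
    hf.mono_set (by rw [uIcc_of_le hab]; exact ordConnected_Icc.uIcc_subset hu hv)
  have ha : a ∈ Icc a b := left_mem_Icc.2 hab
  have h := intervalIntegral_pos_of_pos_on (hsub x hx y hy)
    (fun u hu => hpos u ⟨hx.1.trans_lt hu.1, hu.2.trans_le hy.2⟩) hxy
  rw [← integral_interval_sub_left (hsub a ha y hy) (hsub a ha x hx)] at h
  exact sub_pos.1 h

/-- Regularising time change: if `γ : [0,1] → ℝ` is continuous, continuously differentiable
and positive on `(0,1)`, with `∫₀¹ 1/γ` finite and `γ'·γ` continuously extendable to `[0,1]`,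
then there is a strictly increasing, bijective, continuously differentiable time change
`θ : [0,1] → [0,1]` such that `ĉ(t) = (γ'(θ(t)) − ε/γ(θ(t)))·θ'(t)` admits a continuous
extension to `[0,1]`.  Moreover `θ` can be taken as the inverse of
`s(t) = (1/C)·∫₀ᵗ ε/γ` with `C = ε·∫₀¹ 1/γ`, in which case `θ'(t) = (C/ε)·γ(θ(t))` and
`ĉ(t) = (C/ε)·γ'(θ(t))·γ(θ(t)) − C` on `(0,1)`. -/
theorem exists_regularising_time_change
    (ε : ℝ) (hε : 0 < ε)
    (γ : ℝ → ℝ)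
    (hγcont : ContinuousOn γ (Set.Icc (0 : ℝ) 1))
    (hγC1 : ContDiffOn ℝ 1 γ (Set.Ioo (0 : ℝ) 1))
    (hγpos : ∀ t ∈ Set.Ioo (0 : ℝ) 1, 0 < γ t)
    (hγint : IntervalIntegrable (fun t => 1 / γ t) MeasureTheory.volume 0 1)
    (hext : ∃ g : ℝ → ℝ, ContinuousOn g (Set.Icc (0 : ℝ) 1) ∧
      ∀ t ∈ Set.Ioo (0 : ℝ) 1, g t = deriv γ t * γ t) :
    ∃ θ : ℝ → ℝ,
      StrictMonoOn θ (Set.Icc (0 : ℝ) 1) ∧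
      Set.BijOn θ (Set.Icc (0 : ℝ) 1) (Set.Icc (0 : ℝ) 1) ∧
      θ 0 = 0 ∧ θ 1 = 1 ∧
      ContDiffOn ℝ 1 θ (Set.Icc (0 : ℝ) 1) ∧
      (∃ chat : ℝ → ℝ, ContinuousOn chat (Set.Icc (0 : ℝ) 1) ∧
        ∀ t ∈ Set.Ioo (0 : ℝ) 1,
          chat t = (deriv γ (θ t) - ε / γ (θ t)) * deriv θ t) ∧
      -- moreover, θ is the inverse of s(t) = (1/C)·∫₀ᵗ ε/γ with C = ε·∫₀¹ 1/γ :
      (∀ t ∈ Set.Icc (0 : ℝ) 1,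
        (1 / (ε * ∫ σ in (0 : ℝ)..1, 1 / γ σ)) * ∫ σ in (0 : ℝ)..(θ t), ε / γ σ = t) ∧
      (∀ t ∈ Set.Ioo (0 : ℝ) 1,
        deriv θ t = ((ε * ∫ σ in (0 : ℝ)..1, 1 / γ σ) / ε) * γ (θ t)) ∧
      (∀ t ∈ Set.Ioo (0 : ℝ) 1,
        (deriv γ (θ t) - ε / γ (θ t)) * deriv θ t
          = ((ε * ∫ σ in (0 : ℝ)..1, 1 / γ σ) / ε) * (deriv γ (θ t) * γ (θ t))
            - ε * ∫ σ in (0 : ℝ)..1, 1 / γ σ) := by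
  obtain ⟨g, hg, hgeq⟩ := hext
  set I : ℝ := ∫ σ in (0 : ℝ)..1, 1 / γ σ
  have hinvpos : ∀ t ∈ Ioo (0 : ℝ) 1, 0 < 1 / γ t := fun t ht => one_div_pos.2 (hγpos t ht)
  have hIpos : 0 < I := intervalIntegral_pos_of_pos_on hγint hinvpos one_pos
  let s : ℝ → ℝ := fun x => (∫ σ in (0 : ℝ)..x, 1 / γ σ) / I
  have hs0 : s 0 = 0 := by simp [s]
  have hs1 : s 1 = 1 := div_self hIpos.ne'
  have hsmono : StrictMonoOn s (Icc 0 1) := fun x hx y hy hxy =>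
    div_lt_div_of_pos_right (strictMonoOn_primitive_of_pos hγint hinvpos hx hy hxy) hIpos
  have hscont : ContinuousOn s (Icc 0 1) := by
    have := continuousOn_primitive_interval' hγint (left_mem_uIcc)
    rw [uIcc_of_le zero_le_one] at this
    exact this.div_const I
  have hsderiv : ∀ x ∈ Ioo (0 : ℝ) 1, HasDerivAt s (1 / γ x / I) x := by
    intro x hx
    have hcont : ContinuousOn (fun t => 1 / γ t) (Ioo 0 1) :=
      continuousOn_const.div hγC1.continuousOn fun t ht => (hγpos t ht).ne'
    refine (integral_hasDerivAt_right (hγint.mono_set ?_)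
      (hcont.stronglyMeasurableAtFilter isOpen_Ioo x hx)
      (hcont.continuousAt (isOpen_Ioo.mem_nhds hx))).div_const I
    rw [uIcc_of_le hx.1.le, uIcc_of_le zero_le_one]
    exact Icc_subset_Icc_right hx.2.le
  obtain ⟨θ, hθcont, hθmem, hsθ, hθs⟩ :=
    hsmono.exists_continuous_inverse_Icc zero_le_one hscont
  rw [hs0, hs1] at hsθ
  have hθ0 : θ 0 = 0 := by simpa [hs0] using hθs 0 (by simp)
  have hθ1 : θ 1 = 1 := by simpa [hs1] using hθs 1 (by simp)
  have hθmono : StrictMonoOn θ (Icc 0 1) := fun x hx y hy hxy => by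
    rwa [← hsmono.lt_iff_lt (hθmem x) (hθmem y), hsθ x hx, hsθ y hy]
  have hθIoo : ∀ t ∈ Ioo (0 : ℝ) 1, θ t ∈ Ioo (0 : ℝ) 1 := fun t ht =>
    ⟨hθ0 ▸ hθmono (by simp) (Ioo_subset_Icc_self ht) ht.1,
      hθ1 ▸ hθmono (Ioo_subset_Icc_self ht) (by simp) ht.2⟩
  have hθderiv : ∀ t ∈ Ioo (0 : ℝ) 1, HasDerivAt θ (I * γ (θ t)) t := by
    intro t ht
    have hpos := hγpos _ (hθIoo t ht)
    have h := (hsderiv _ (hθIoo t ht)).of_local_left_inverse hθcont.continuousAt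
      (by positivity) (by
        filter_upwards [isOpen_Ioo.mem_nhds ht] with y hy
        exact hsθ y (Ioo_subset_Icc_self hy))
    rwa [div_div, one_div, inv_inv, mul_comm] at h
  have hderiv : ∀ t ∈ Ioo (0 : ℝ) 1, deriv θ t = ε * I / ε * γ (θ t) := fun t ht => by
    rw [(hθderiv t ht).deriv, mul_div_cancel_left₀ I hε.ne']
  have hchat : ∀ t ∈ Ioo (0 : ℝ) 1, (deriv γ (θ t) - ε / γ (θ t)) * deriv θ t =
      ε * I / ε * (deriv γ (θ t) * γ (θ t)) - ε * I := by
    intro t ht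
    have hpos := hγpos _ (hθIoo t ht)
    rw [hderiv t ht]
    field_simp
  refine ⟨θ, hθmono, ⟨fun t _ => hθmem t, hθmono.injOn, fun x hx => ?_⟩, hθ0, hθ1,
    contDiffOn_one_Icc_of_hasDerivAt_Ioo hθcont.continuousOn
      (continuous_const.mul (hγcont.comp_continuous hθcont hθmem)) hθderiv,
    ⟨fun t => ε * I / ε * g (θ t) - ε * I, ?_, fun t ht => ?_⟩, fun t ht => ?_, hderiv, hchat⟩
  · refine ⟨s x, ⟨?_, ?_⟩, hθs x hx⟩
    · exact hs0 ▸ hsmono.monotoneOn (by simp) hx hx.1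
    · exact hs1 ▸ hsmono.monotoneOn hx (by simp) hx.2
  · exact ((continuous_const.mul (hg.comp_continuous hθcont hθmem)).sub
      continuous_const).continuousOn
  · simp only [hchat t ht, hgeq _ (hθIoo t ht)]
  · have hint : ∫ σ in (0 : ℝ)..θ t, ε / γ σ = ε * ∫ σ in (0 : ℝ)..θ t, 1 / γ σ := by
      rw [← intervalIntegral.integral_const_mul]
      simp only [mul_one_div]
    rw [hint]
    conv_rhs => rw [← hsθ t ht]
    simp only [s]
    field_simp
end

section
/- Let H be a real Hilbert space, T > 0, x₀ ∈ H, and let W : [0,T] → H be continuous. Let f, f̃ : [0,T] × H → H be continuous maps, and suppose there is Λ ≥ 0 such that ‖f̃(s,x) − f̃(s,y)‖ ≤ Λ·‖x − y‖ for all s ∈ [0,T] and x, y ∈ H. Let X and X̃ be continuous functions from [0,T] to H satisfying X(t) = x₀ + ∫₀ᵗ f(s, X(s)) ds + W(t) and X̃(t) = x₀ + ∫₀ᵗ f̃(s, X̃(s)) ds + W(t) for all t ∈ [0,T]. Then for every t ∈ [0,T], ‖X̃(t) − X(t)‖² ≤ e^{(2Λ+1)·t} · ∫₀ᵗ ‖f̃(s,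 X(s)) − f(s, X(s))‖² ds. -/
open Set MeasureTheory intervalIntegral

theorem hasDerivAt_integral_of_continuousOn_Icc
    {E : Type*} [NormedAddCommGroup E] [NormedSpace ℝ E] [CompleteSpace E] {u : ℝ → E} {a b t : ℝ}
    (hu : ContinuousOn u (Icc a b)) (ht : t ∈ Ioo a b) :
    HasDerivAt (fun x => ∫ s in a..x, u s) (u t) t := by
  refine integral_hasDerivAt_right ?_ ?_ (hu.continuousAt (Icc_mem_nhds ht.1 ht.2))
  · refine ContinuousOn.intervalIntegrable (hu.mono ?_)
    rw [uIcc_of_le ht.1.le]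
    exact Icc_subset_Icc_right ht.2.le
  · exact (hu.mono Ioo_subset_Icc_self).stronglyMeasurableAtFilter isOpen_Ioo t ht

/-- Energy form of Grönwall's inequality for a path started at `0` whose velocity `v` satisfies
`2 ⟪D, v⟫ ≤ K ‖D‖² + g`. -/
theorem norm_sq_le_exp_mul_integral_of_inner_le
    {H : Type*} [NormedAddCommGroup H] [InnerProductSpace ℝ H] {T K : ℝ} (hK : 0 ≤ K)
    {D v : ℝ → H} {g : ℝ → ℝ} (hD : ContinuousOn D (Icc 0 T)) (hD0 : D 0 = 0)
    (hD' : ∀ t ∈ Ioo 0 T, HasDerivAt D (v t) t)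
    (hg : ContinuousOn g (Icc 0 T)) (hg0 : ∀ t ∈ Icc 0 T, 0 ≤ g t)
    (hle : ∀ t ∈ Ioo 0 T, 2 * inner ℝ (D t) (v t) ≤ K * ‖D t‖ ^ 2 + g t) :
    ∀ t ∈ Icc 0 T, ‖D t‖ ^ 2 ≤ Real.exp (K * t) * ∫ s in (0 : ℝ)..t, g s := by
  intro t ht
  have hT : 0 ≤ T := ht.1.trans ht.2
  have hderiv : ∀ s ∈ Ioo 0 T, HasDerivAt
      (fun s => Real.exp (-(K * s)) * ‖D s‖ ^ 2 - ∫ r in (0 : ℝ)..s, g r)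
      (Real.exp (-(K * s)) * -(K * 1) * ‖D s‖ ^ 2
        + Real.exp (-(K * s)) * (2 * inner ℝ (D s) (v s)) - g s) s := fun s hs =>
    ((((hasDerivAt_id s).const_mul K).neg.exp).mul (hD' s hs).norm_sq).sub
      (hasDerivAt_integral_of_continuousOn_Icc hg hs)
  have hcont : ContinuousOn
      (fun s => Real.exp (-(K * s)) * ‖D s‖ ^ 2 - ∫ r in (0 : ℝ)..s, g r) (Icc 0 T) := by
    refine ContinuousOn.sub (ContinuousOn.mul (by fun_prop) (hD.norm.pow 2)) ?_
    have := continuousOn_primitive_interval (μ := volume) (f := g) (a := 0) (b := T)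
      (by rw [uIcc_of_le hT]; exact hg.integrableOn_Icc)
    rwa [uIcc_of_le hT] at this
  have hanti := antitoneOn_of_deriv_nonpos (convex_Icc 0 T) hcont
    (fun s hs => (hderiv s (by rwa [interior_Icc] at hs)).differentiableAt.differentiableWithinAt)
    (fun s hs => by
      rw [interior_Icc] at hs
      rw [(hderiv s hs).deriv]
      have hexp : Real.exp (-(K * s)) ≤ 1 :=
        Real.exp_le_one_iff.2 (neg_nonpos.2 (mul_nonneg hK hs.1.le))
      have hv := mul_le_mul_of_nonneg_left (hle s hs) (Real.exp_pos (-(K * s))).le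
      have hgs := mul_le_of_le_one_left (hg0 s (Ioo_subset_Icc_self hs)) hexp
      linarith)
  have hmain := hanti (left_mem_Icc.2 hT) ht ht.1
  simp only [hD0, norm_zero, integral_same, sub_nonpos, ne_eq, OfNat.ofNat_ne_zero,
    not_false_eq_true, zero_pow, mul_zero, sub_zero] at hmain
  calc ‖D t‖ ^ 2 = Real.exp (K * t) * (Real.exp (-(K * t)) * ‖D t‖ ^ 2) := by
        rw [← mul_assoc, ← Real.exp_add, add_neg_cancel, Real.exp_zero, one_mul]
    _ ≤ _ := mul_le_mul_of_nonneg_left hmain (Real.exp_pos _).le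

/-- Pathwise Grönwall-type stability estimate: if `X` and `X̃` solve the perturbed integral
equations driven by the same noise path `W`, with drifts `f` and `f̃` respectively, and `f̃` is
`Λ`-Lipschitz in its second argument, then
`‖X̃(t) − X(t)‖² ≤ e^{(2Λ+1)t} · ∫₀ᵗ ‖f̃(s, X(s)) − f(s, X(s))‖² ds`. -/
theorem pathwise_drift_approximation_error_bound
    {H : Type*} [NormedAddCommGroup H] [InnerProductSpace ℝ H] [CompleteSpace H]
    (T : ℝ) (hT : 0 < T) (x₀ : H)
    (W : ℝ → H) (hW : ContinuousOn W (Set.Icc 0 T))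
    (f ftil : ℝ → H → H)
    (hf : ContinuousOn (fun p : ℝ × H => f p.1 p.2) (Set.Icc 0 T ×ˢ Set.univ))
    (hftil : ContinuousOn (fun p : ℝ × H => ftil p.1 p.2) (Set.Icc 0 T ×ˢ Set.univ))
    (Λ : ℝ) (hΛ : 0 ≤ Λ)
    (hLip : ∀ s ∈ Set.Icc 0 T, ∀ x y : H, ‖ftil s x - ftil s y‖ ≤ Λ * ‖x - y‖)
    (X Xtil : ℝ → H)
    (hX : ContinuousOn X (Set.Icc 0 T)) (hXtil : ContinuousOn Xtil (Set.Icc 0 T))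
    (hXeq : ∀ t ∈ Set.Icc 0 T, X t = x₀ + (∫ s in (0 : ℝ)..t, f s (X s)) + W t)
    (hXtileq : ∀ t ∈ Set.Icc 0 T, Xtil t = x₀ + (∫ s in (0 : ℝ)..t, ftil s (Xtil s)) + W t) :
    ∀ t ∈ Set.Icc 0 T,
      ‖Xtil t - X t‖ ^ 2
        ≤ Real.exp ((2 * Λ + 1) * t) * ∫ s in (0 : ℝ)..t, ‖ftil s (X s) - f s (X s)‖ ^ 2 := by
  have hcomp : ∀ {F : ℝ → H → H} {Y : ℝ → H},
      ContinuousOn (fun p : ℝ × H => F p.1 p.2) (Icc 0 T ×ˢ univ) → ContinuousOn Y (Icc 0 T) →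
      ContinuousOn (fun s => F s (Y s)) (Icc 0 T) := fun hF hY =>
    hF.comp (continuousOn_id.prodMk hY) fun s hs => ⟨hs, mem_univ _⟩
  have hfX := hcomp hf hX
  have hftilX := hcomp hftil hX
  have hftilXtil := hcomp hftil hXtil
  have hdiff : ∀ t ∈ Icc 0 T, Xtil t - X t =
      (∫ s in (0 : ℝ)..t, ftil s (Xtil s)) - ∫ s in (0 : ℝ)..t, f s (X s) := fun t ht => by
    rw [hXeq t ht, hXtileq t ht]
    abel
  refine norm_sq_le_exp_mul_integral_of_inner_le (D := fun t => Xtil t - X t)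
    (v := fun t => ftil t (Xtil t) - f t (X t)) (by positivity) (hXtil.sub hX)
    (by simp [hdiff 0 (left_mem_Icc.2 hT.le)]) (fun t ht => ?_) ((hftilX.sub hfX).norm.pow 2)
    (fun t _ => by positivity) (fun t ht => ?_)
  · refine ((hasDerivAt_integral_of_continuousOn_Icc hftilXtil ht).sub
      (hasDerivAt_integral_of_continuousOn_Icc hfX ht)).congr_of_eventuallyEq ?_
    filter_upwards [Icc_mem_nhds ht.1 ht.2] with s hs using hdiff s hs
  · have hsplit : ftil t (Xtil t) - f t (X t) =
        (ftil t (Xtil t) - ftil t (X t)) + (ftil t (X t) - f t (X t)) := by abel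
    have hL := hLip t (Ioo_subset_Icc_self ht) (Xtil t) (X t)
    have h₁ := real_inner_le_norm (Xtil t - X t) (ftil t (Xtil t) - ftil t (X t))
    have h₂ := real_inner_le_norm (Xtil t - X t) (ftil t (X t) - f t (X t))
    have h₃ := mul_le_mul_of_nonneg_left hL (norm_nonneg (Xtil t - X t))
    have h₄ := two_mul_le_add_sq ‖Xtil t - X t‖ ‖ftil t (X t) - f t (X t)‖
    simp only [hsplit, inner_add_right]
    linarith
end

section
/- Let H be a real Hilbert space, let R > 0, and let ν be a Borel probability measure on H supported in the closed ball of radius R centered at the origin. Fix a ∈ H and β, γ > 0, and for x ∈ H define the potential V(x₁, x) = ‖a + β·x₁ − x‖²/(2γ²), the normalising constant Z(x) = ∫ exp(−V(x₁, x)) dν(x₁), and the tilted mean m(x) = Z(x)⁻¹ · ∫ x₁ · exp(−V(x₁, x)) dν(x₁). Then the map x ↦ m(x) is Lipschitz continuous on H with constant R²·β/γ²; that is, for all x, y ∈ H, ‖m(x) − m(y)‖ ≤ (R²·β/γ²)·‖x − y‖. -/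
open MeasureTheory

open ProbabilityTheory in
/-- The covariance of two bounded random variables is at most the product of their bounds. -/
lemma covariance_le_mul_of_abs_le {Ω : Type*} [MeasurableSpace Ω] {μ : Measure Ω}
    [IsProbabilityMeasure μ] {X Y : Ω → ℝ} {c d : ℝ} (hc : 0 < c) (hd : 0 < d)
    (hX : AEStronglyMeasurable X μ) (hY : AEStronglyMeasurable Y μ)
    (hXc : ∀ᵐ ω ∂μ, |X ω| ≤ c) (hYd : ∀ᵐ ω ∂μ, |Y ω| ≤ d) :
    cov[X, Y; μ] ≤ c * d := by
  have hX2 : MemLp X 2 μ := MemLp.of_bound hX c hXc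
  have hY2 : MemLp Y 2 μ := MemLp.of_bound hY d hYd
  have vX : Var[X; μ] ≤ c ^ 2 := by
    refine (variance_le_sq_of_bounded (a := -c) (b := c) ?_ hX.aemeasurable).trans_eq (by ring)
    filter_upwards [hXc] with ω h using abs_le.1 h
  have vY : Var[Y; μ] ≤ d ^ 2 := by
    refine (variance_le_sq_of_bounded (a := -d) (b := d) ?_ hY.aemeasurable).trans_eq (by ring)
    filter_upwards [hYd] with ω h using abs_le.1 h
  have h := variance_nonneg (d • X - c • Y) μ
  rw [variance_sub (hX2.const_smul d) (hY2.const_smul c), variance_smul, variance_smul,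
    covariance_smul_left, covariance_smul_right] at h
  have h1 := mul_le_mul_of_nonneg_left vX (sq_nonneg d)
  have h2 := mul_le_mul_of_nonneg_left vY (sq_nonneg c)
  have h3 : (c * d) * cov[X, Y; μ] ≤ (c * d) * (c * d) := by nlinarith
  exact le_of_mul_le_mul_left h3 (mul_pos hc hd)

lemma integrable_exp_of_abs_le {Ω : Type*} [MeasurableSpace Ω] {μ : Measure Ω}
    [IsFiniteMeasure μ] {Y : Ω → ℝ} {d : ℝ} (hY : AEStronglyMeasurable Y μ)
    (hYd : ∀ᵐ ω ∂μ, |Y ω| ≤ d) : Integrable (fun ω ↦ Real.exp (Y ω)) μ := by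
  refine Integrable.of_bound (Real.continuous_exp.comp_aestronglyMeasurable hY) (Real.exp d) ?_
  filter_upwards [hYd] with ω h
  rw [Real.norm_eq_abs, Real.abs_exp]
  exact Real.exp_le_exp.2 ((le_abs_self _).trans h)

/-- Differentiation under the integral sign for exponential tilts by a bounded function. -/
lemma hasDerivAt_integral_exp_mul {Ω : Type*} [MeasurableSpace Ω] {μ : Measure Ω}
    [IsFiniteMeasure μ] {X Y : Ω → ℝ} {c d : ℝ}
    (hX : AEStronglyMeasurable X μ) (hY : AEStronglyMeasurable Y μ)
    (hXc : ∀ᵐ ω ∂μ, |X ω| ≤ c) (hYd : ∀ᵐ ω ∂μ, |Y ω| ≤ d) (t : ℝ) :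
    HasDerivAt (fun s : ℝ ↦ ∫ ω, Real.exp (s * Y ω) * X ω ∂μ)
      (∫ ω, Real.exp (t * Y ω) * (X ω * Y ω) ∂μ) t := by
  have hexp (s : ℝ) : AEStronglyMeasurable (fun ω ↦ Real.exp (s * Y ω)) μ :=
    Real.continuous_exp.comp_aestronglyMeasurable (hY.const_mul s)
  have hbd (s : ℝ) : ∀ᵐ ω ∂μ, |s * Y ω| ≤ |s| * d := by
    filter_upwards [hYd] with ω h
    rw [abs_mul]
    gcongr
  refine (hasDerivAt_integral_of_dominated_loc_of_deriv_le
    (F := fun s ω ↦ Real.exp (s * Y ω) * X ω)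
    (F' := fun s ω ↦ Real.exp (s * Y ω) * (X ω * Y ω))
    (bound := fun _ ↦ Real.exp ((|t| + 1) * d) * (c * d))
    (Metric.ball_mem_nhds t one_pos) (Filter.Eventually.of_forall fun s ↦ (hexp s).mul hX)
    ?_ ((hexp t).mul (hX.mul hY)) ?_ (integrable_const _) ?_).2
  · exact (integrable_exp_of_abs_le (hY.const_mul t) (hbd t)).mul_bdd hX hXc
  · filter_upwards [hXc, hYd] with ω hx hy s hs
    have hs' : |s| ≤ |t| + 1 := by
      have := abs_sub_abs_le_abs_sub s t
      rw [Metric.mem_ball, Real.dist_eq] at hs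
      linarith
    have hsy : s * Y ω ≤ (|t| + 1) * d := by
      refine (le_abs_self _).trans ?_
      rw [abs_mul]
      gcongr
    rw [Real.norm_eq_abs, abs_mul, abs_mul, Real.abs_exp]
    have hc : 0 ≤ c := (abs_nonneg _).trans hx
    gcongr
  · filter_upwards with ω s _
    have h := (((hasDerivAt_id s).mul_const (Y ω)).exp).mul_const (X ω)
    refine h.congr_deriv ?_
    simp only [id]
    ring

lemma integral_tilted_eq_inv_smul {Ω E : Type*} [MeasurableSpace Ω] [NormedAddCommGroup E]
    [NormedSpace ℝ E] (μ : Measure Ω) (f : Ω → ℝ) (g : Ω → E) :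
    ∫ ω, g ω ∂(μ.tilted f) = (∫ ω, Real.exp (f ω) ∂μ)⁻¹ • ∫ ω, Real.exp (f ω) • g ω ∂μ := by
  rw [integral_tilted, ← integral_smul]
  simp_rw [div_eq_inv_mul, mul_smul]

open ProbabilityTheory in
lemma hasDerivAt_integral_tilted {Ω : Type*} [MeasurableSpace Ω] {μ : Measure Ω}
    [IsProbabilityMeasure μ] {X Y : Ω → ℝ} {c d : ℝ}
    (hX : AEStronglyMeasurable X μ) (hY : AEStronglyMeasurable Y μ)
    (hXc : ∀ᵐ ω ∂μ, |X ω| ≤ c) (hYd : ∀ᵐ ω ∂μ, |Y ω| ≤ d) (t : ℝ) :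
    HasDerivAt (fun s : ℝ ↦ ∫ ω, X ω ∂(μ.tilted fun ω ↦ s * Y ω))
      cov[X, Y; μ.tilted fun ω ↦ t * Y ω] t := by
  have hi : Integrable (fun ω ↦ Real.exp (t * Y ω)) μ := by
    refine integrable_exp_of_abs_le (d := |t| * d) (hY.const_mul t) ?_
    filter_upwards [hYd] with ω h
    rw [abs_mul]
    gcongr
  have hac := tilted_absolutelyContinuous μ (fun ω ↦ t * Y ω)
  have := isProbabilityMeasure_tilted hi
  have hN := hasDerivAt_integral_exp_mul hX hY hXc hYd t
  have hZ := hasDerivAt_integral_exp_mul (X := fun _ ↦ 1) (c := 1)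
    aestronglyMeasurable_const hY (by simp) hYd t
  simp only [mul_one, one_mul] at hZ
  have hpos := integral_exp_pos hi
  rw [covariance_eq_sub (MemLp.of_bound (hX.mono_ac hac) c (hac hXc))
    (MemLp.of_bound (hY.mono_ac hac) d (hac hYd))]
  simp_rw [integral_tilted_eq_inv_smul, smul_eq_mul, Pi.mul_apply]
  refine ((hZ.inv hpos.ne').mul hN).congr_deriv ?_
  simp only [Pi.inv_apply]
  field_simp
  ring

/-- Tilting by a function bounded by `d` moves the mean of a function bounded by `c` by at most
`c * d`. -/
lemma integral_tilted_sub_integral_le {Ω : Type*} [MeasurableSpace Ω] {μ : Measure Ω}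
    [IsProbabilityMeasure μ] {X Y : Ω → ℝ} {c d : ℝ} (hc : 0 < c) (hd : 0 < d)
    (hX : AEStronglyMeasurable X μ) (hY : AEStronglyMeasurable Y μ)
    (hXc : ∀ᵐ ω ∂μ, |X ω| ≤ c) (hYd : ∀ᵐ ω ∂μ, |Y ω| ≤ d) :
    ∫ ω, X ω ∂(μ.tilted Y) - ∫ ω, X ω ∂μ ≤ c * d := by
  have hder := hasDerivAt_integral_tilted hX hY hXc hYd
  have h := image_sub_le_mul_sub_of_deriv_le (C := c * d)
    (fun t ↦ (hder t).differentiableAt) (fun t ↦ ?_) zero_le_one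
  · simpa using h
  · rw [(hder t).deriv]
    have hac := tilted_absolutelyContinuous μ (fun ω ↦ t * Y ω)
    have : IsProbabilityMeasure (μ.tilted fun ω ↦ t * Y ω) := by
      refine isProbabilityMeasure_tilted
        (integrable_exp_of_abs_le (d := |t| * d) (hY.const_mul t) ?_)
      filter_upwards [hYd] with ω h
      rw [abs_mul]
      gcongr
    exact covariance_le_mul_of_abs_le hc hd (hX.mono_ac hac) (hY.mono_ac hac) (hac hXc) (hac hYd)

lemma tilted_add_const {Ω : Type*} [MeasurableSpace Ω] (μ : Measure Ω) (f : Ω → ℝ) (k : ℝ) :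
    μ.tilted (fun ω ↦ f ω + k) = μ.tilted f := by
  have h (ω : Ω) : Real.exp (f ω + k) / ∫ x, Real.exp (f x + k) ∂μ
      = Real.exp (f ω) / ∫ x, Real.exp (f x) ∂μ := by
    simp_rw [Real.exp_add, integral_mul_const]
    exact mul_div_mul_right _ _ (Real.exp_ne_zero k)
  simp_rw [Measure.tilted, h]

/-- Lipschitz continuity of the tilted (posterior) mean under bounded support: for a
probability measure `ν` supported in the closed ball of radius `R`, potential
`V(x₁,x) = ‖a + β·x₁ − x‖²/(2γ²)`, normalising constant `Z(x) = ∫ e^{−V(x₁,x)} dν(x₁)`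
and tilted mean `m(x) = Z(x)⁻¹·∫ x₁ e^{−V(x₁,x)} dν(x₁)`, the map `x ↦ m(x)` is Lipschitz
with constant `R²·β/γ²`. -/
theorem tilted_mean_lipschitz_of_bounded_support
    {H : Type*} [NormedAddCommGroup H] [InnerProductSpace ℝ H] [CompleteSpace H]
    [MeasurableSpace H] [BorelSpace H]
    (R : ℝ) (hR : 0 < R)
    (ν : Measure H) [IsProbabilityMeasure ν]
    (hsupp : ∀ᵐ x₁ ∂ν, ‖x₁‖ ≤ R)
    (a : H) (β γ : ℝ) (hβ : 0 < β) (hγ : 0 < γ)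
    (V : H → H → ℝ) (hV : ∀ x₁ x, V x₁ x = ‖a + β • x₁ - x‖ ^ 2 / (2 * γ ^ 2))
    (Z : H → ℝ) (hZ : ∀ x, Z x = ∫ x₁, Real.exp (-(V x₁ x)) ∂ν)
    (m : H → H) (hm : ∀ x, m x = (Z x)⁻¹ • ∫ x₁, Real.exp (-(V x₁ x)) • x₁ ∂ν) :
    ∀ x y : H, ‖m x - m y‖ ≤ (R ^ 2 * β / γ ^ 2) * ‖x - y‖ := by
  intro x y
  have hVcont (z : H) : Continuous fun x₁ ↦ -(V x₁ z) := by
    simp_rw [hV]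
    fun_prop
  have hVint (z : H) : Integrable (fun x₁ ↦ Real.exp (-(V x₁ z))) ν := by
    refine Integrable.of_bound
      (Real.continuous_exp.comp (hVcont z)).measurable.aestronglyMeasurable 1 ?_
    filter_upwards with x₁
    rw [Real.norm_eq_abs, Real.abs_exp, Real.exp_le_one_iff, hV, neg_nonpos]
    positivity
  have hmean (z : H) : m z = ∫ x₁, x₁ ∂(ν.tilted fun x₁ ↦ -(V x₁ z)) := by
    rw [hm, hZ, integral_tilted_eq_inv_smul]
  have hbound : 0 ≤ (R ^ 2 * β / γ ^ 2) * ‖x - y‖ := by positivity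
  by_cases hid : AEStronglyMeasurable (fun x₁ : H ↦ x₁) ν
  swap
  -- On a non-separable space the identity may fail to be integrable; both means are then zero.
  · have hzero (z : H) : m z = 0 := by
      rw [hmean]
      refine integral_undef fun h ↦ hid ?_
      exact h.aestronglyMeasurable.mono_ac (absolutelyContinuous_tilted (hVint z))
    simpa [hzero] using hbound
  have hidint (z : H) : Integrable (fun x₁ : H ↦ x₁) (ν.tilted fun x₁ ↦ -(V x₁ z)) := by
    have hac := tilted_absolutelyContinuous ν fun x₁ ↦ -(V x₁ z)
    have := isProbabilityMeasure_tilted (hVint z)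
    exact Integrable.of_bound (hid.mono_ac hac) R (hac hsupp)
  rcases eq_or_ne (m x) (m y) with hmxy | hmxy
  · simpa [hmxy] using hbound
  have hxy : 0 < ‖x - y‖ := norm_pos_iff.2 (sub_ne_zero.2 fun h ↦ hmxy (by rw [h]))
  set w := m x - m y with hw
  have hwpos : 0 < ‖w‖ := norm_pos_iff.2 (sub_ne_zero.2 hmxy)
  set Y : H → ℝ := fun x₁ ↦ (β / γ ^ 2) * inner ℝ (x - y) x₁ with hY
  have hprob := isProbabilityMeasure_tilted (hVint y)
  have hac := tilted_absolutelyContinuous ν fun x₁ ↦ -(V x₁ y)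
  have htilt : ν.tilted (fun x₁ ↦ -(V x₁ x)) = (ν.tilted fun x₁ ↦ -(V x₁ y)).tilted Y := by
    rw [tilted_tilted (hVint y), ← tilted_add_const ν _
      ((‖a - x‖ ^ 2 - ‖a - y‖ ^ 2) / (2 * γ ^ 2))]
    congr 1
    funext x₁
    have hexpand (z : H) : ‖a + β • x₁ - z‖ ^ 2
        = ‖a - z‖ ^ 2 + 2 * β * (inner ℝ a x₁ - inner ℝ z x₁) + ‖β • x₁‖ ^ 2 := by
      rw [show a + β • x₁ - z = (a - z) + β • x₁ by abel, norm_add_sq_real, inner_smul_right,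
        inner_sub_left]
      ring
    simp only [Pi.add_apply, hV, hY, hexpand, inner_sub_left]
    field_simp
    ring
  have hcov := integral_tilted_sub_integral_le (μ := ν.tilted fun x₁ ↦ -(V x₁ y))
    (X := fun x₁ ↦ inner ℝ w x₁) (Y := Y) (c := ‖w‖ * R) (d := β / γ ^ 2 * (‖x - y‖ * R))
    (by positivity) (by positivity)
    (Continuous.measurable (by fun_prop)).aestronglyMeasurable
    (Continuous.measurable (by fun_prop)).aestronglyMeasurable
    (by
      filter_upwards [hac hsupp] with x₁ h
      exact (abs_real_inner_le_norm _ _).trans (by gcongr))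
    (by
      filter_upwards [hac hsupp] with x₁ h
      rw [hY, abs_mul, abs_of_pos (by positivity : 0 < β / γ ^ 2)]
      gcongr
      exact (abs_real_inner_le_norm _ _).trans (by gcongr))
  rw [← htilt, integral_inner (hidint x), integral_inner (hidint y), ← hmean, ← hmean,
    ← inner_sub_right, ← hw, real_inner_self_eq_norm_sq] at hcov
  refine le_of_mul_le_mul_left ?_ hwpos
  calc ‖w‖ * ‖w‖ = ‖w‖ ^ 2 := by ring
    _ ≤ _ := hcov
    _ = _ := by ring
end

section
/- Let N ≥ 1, let Φ : ℝᴺ → ℝ be twice continuously differentiable and k-strongly convex for some k > 0, i.e., ⟨∇²Φ(x)·u, u⟩ ≥ k·‖u‖² for all x, u ∈ ℝᴺ. Fix a ∈ ℝᴺ and β, γ > 0, and suppose that for every x ∈ ℝᴺ the integral Z(x) = ∫_{ℝᴺ} exp(−‖a + β·x₁ − x‖²/(2γ²) − Φ(x₁)) dx₁ is finite (it is automatically strictly positive), so that μ_x with Lebesgue density Z(x)⁻¹·exp(−‖a + β·x₁ − x‖²/(2γ²) − Φ(x₁)) is a probability measure with well-defined mean m(x) = ∫ x₁ dμ_x(x₁).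 Then the map x ↦ m(x) is Lipschitz continuous with constant β/(β² + k·γ²); that is, for all x, y ∈ ℝᴺ, ‖m(x) − m(y)‖ ≤ (β/(β² + k·γ²))·‖x − y‖. -/
open MeasureTheory
open scoped ENNReal

theorem volume_add_volume_le_of_isCompact {A B S : Set ℝ} (hA : IsCompact A) (hA' : A.Nonempty)
    (hB : IsCompact B) (hB' : B.Nonempty)
    (hS : ∀ x ∈ A, ∀ y ∈ B, (1 / 2 : ℝ) • (x + y) ∈ S) :
    volume A + volume B ≤ 2 * volume S := by
  obtain ⟨a, haA, ha⟩ := hA.exists_isGreatest hA'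
  obtain ⟨b, hbB, hb⟩ := hB.exists_isLeast hB'
  have scale (c : ℝ) (T : Set ℝ) : volume {x : ℝ | (1 / 2 : ℝ) * (x + c) ∈ T} = 2 * volume T := by
    have h := measure_preimage_add_right (volume : Measure ℝ) c ((fun x => (1 / 2 : ℝ) * x) ⁻¹' T)
    rw [Real.volume_preimage_mul_left (by norm_num)] at h
    rw [show ENNReal.ofReal |(1 / 2 : ℝ)⁻¹| = 2 by norm_num] at h
    exact h
  set p : ℝ := (1 / 2 : ℝ) * (a + b) with hp
  have h1 : volume A ≤ 2 * volume (S ∩ Set.Iic p) := by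
    rw [← scale b]
    refine measure_mono fun x hx => ⟨hS x hx b hbB, ?_⟩
    have := ha hx
    simp only [Set.mem_Iic, hp]
    linarith
  have h2 : volume B ≤ 2 * volume (S ∩ Set.Ici p) := by
    rw [← scale a]
    refine measure_mono fun x hx => ⟨by simpa [add_comm] using hS a haA x hx, ?_⟩
    have := hb hx
    simp only [Set.mem_Ici, hp]
    linarith
  have h3 : volume (S ∩ Set.Ici p) ≤ volume (S \ Set.Iic p) := by
    refine measure_mono_ae ?_
    filter_upwards [compl_mem_ae_iff.mpr (measure_singleton p)] with x hx hxS
    exact ⟨hxS.1, fun h => hx (le_antisymm h hxS.2)⟩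
  calc volume A + volume B ≤ 2 * volume (S ∩ Set.Iic p) + 2 * volume (S \ Set.Iic p) :=
        add_le_add h1 (h2.trans (by gcongr))
    _ = 2 * volume S := by rw [← mul_add, measure_inter_add_sdiff S measurableSet_Iic]

theorem volume_le_iSup_isCompact_nonempty {A : Set ℝ} (hA : MeasurableSet A) :
    volume A ≤ ⨆ K : {K : Set ℝ // K ⊆ A ∧ IsCompact K ∧ K.Nonempty}, volume (K : Set ℝ) := by
  refine le_of_forall_lt fun r hr => ?_
  obtain ⟨K, hKA, hK, hrK⟩ := hA.exists_lt_isCompact hr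
  exact hrK.trans_le (le_iSup
    (fun K : {K : Set ℝ // K ⊆ A ∧ IsCompact K ∧ K.Nonempty} => volume (K : Set ℝ))
    ⟨K, hKA, hK, nonempty_of_measure_ne_zero (ne_bot_of_gt hrK)⟩)

/-- The one-dimensional Brunn-Minkowski inequality, for a set containing all midpoints. -/
theorem volume_add_volume_le {A B S : Set ℝ} (hA : MeasurableSet A) (hA' : A.Nonempty)
    (hB : MeasurableSet B) (hB' : B.Nonempty)
    (hS : ∀ x ∈ A, ∀ y ∈ B, (1 / 2 : ℝ) • (x + y) ∈ S) :
    volume A + volume B ≤ 2 * volume S := by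
  obtain ⟨a, ha⟩ := hA'
  obtain ⟨b, hb⟩ := hB'
  have : Nonempty {K : Set ℝ // K ⊆ A ∧ IsCompact K ∧ K.Nonempty} :=
    ⟨{a}, by simpa using ha, isCompact_singleton, by simp⟩
  have : Nonempty {K : Set ℝ // K ⊆ B ∧ IsCompact K ∧ K.Nonempty} :=
    ⟨{b}, by simpa using hb, isCompact_singleton, by simp⟩
  refine (add_le_add (volume_le_iSup_isCompact_nonempty hA)
    (volume_le_iSup_isCompact_nonempty hB)).trans (ENNReal.iSup_add_iSup_le fun K L => ?_)
  exact volume_add_volume_le_of_isCompact K.2.2.1 K.2.2.2 L.2.2.1 L.2.2.2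
    fun x hx y hy => hS x (K.2.1 hx) y (L.2.1 hy)

/-- The one-dimensional Prékopa-Leindler inequality in arithmetic form, for functions normalised to
have supremum one. -/
theorem lintegral_add_lintegral_le_of_midpoint {f g h : ℝ → ℝ}
    (hf : Measurable f) (hg : Measurable g) (hh : Measurable h)
    (hf0 : 0 ≤ f) (hg0 : 0 ≤ g) (hh0 : 0 ≤ h) (hf1 : f ≤ 1) (hg1 : g ≤ 1)
    (hfs : ∀ t < 1, ∃ x, t < f x) (hgs : ∀ t < 1, ∃ x, t < g x)
    (H : ∀ t, 0 < t → ∀ x y, t < f x → t < g y → t < h ((1 / 2 : ℝ) • (x + y))) :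
    (∫⁻ x, ENNReal.ofReal (f x)) + ∫⁻ x, ENNReal.ofReal (g x) ≤
      2 * ∫⁻ x, ENNReal.ofReal (h x) := by
  rw [lintegral_eq_lintegral_meas_lt _ (.of_forall hf0) hf.aemeasurable,
    lintegral_eq_lintegral_meas_lt _ (.of_forall hg0) hg.aemeasurable,
    lintegral_eq_lintegral_meas_lt _ (.of_forall hh0) hh.aemeasurable]
  have anti (u : ℝ → ℝ) : Antitone fun t => volume {a | t < u a} :=
    fun s t hst => measure_mono fun x (hx : t < u x) => hst.trans_lt hx
  rw [← lintegral_add_left (anti f).measurable, ← lintegral_const_mul _ (anti h).measurable]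
  refine setLIntegral_mono ((anti h).measurable.const_mul 2) fun t (ht : 0 < t) => ?_
  rcases lt_or_ge t 1 with ht1 | ht1
  · exact volume_add_volume_le (measurableSet_lt measurable_const hf) (hfs t ht1)
      (measurableSet_lt measurable_const hg) (hgs t ht1) fun x hx y hy => H t ht x y hx hy
  · have e1 : {a | t < f a} = ∅ := by
      ext x; simpa using (hf1 x).trans ht1
    have e2 : {a | t < g a} = ∅ := by
      ext x; simpa using (hg1 x).trans ht1
    simp [e1, e2]

theorem ENNReal.mul_le_sq_of_add_le {u v w : ℝ≥0∞} (h : u + v ≤ 2 * w) : u * v ≤ w ^ 2 := by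
  rcases eq_or_ne w ∞ with rfl | hw
  · simp
  have h2 : 2 * w ≠ ∞ := ENNReal.mul_ne_top (by simp) hw
  have hu : u ≠ ∞ := ne_top_of_le_ne_top h2 (le_self_add.trans h)
  have hv : v ≠ ∞ := ne_top_of_le_ne_top h2 (le_add_self.trans h)
  lift u to NNReal using hu
  lift v to NNReal using hv
  lift w to NNReal using hw
  norm_cast at h ⊢
  have h' : (u : ℝ) + v ≤ 2 * w := by exact_mod_cast h
  have : (u : ℝ) * v ≤ w ^ 2 := by nlinarith [sq_nonneg ((u : ℝ) - v), u.coe_nonneg, v.coe_nonneg, w.coe_nonneg]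
  exact_mod_cast this

theorem prekopa_leindler_real_of_bounded {f g h : ℝ → ℝ≥0∞}
    (hf : Measurable f) (hg : Measurable g) (hh : Measurable h)
    (hfb : (⨆ x, f x) ≠ ∞) (hgb : (⨆ x, g x) ≠ ∞)
    (H : ∀ x y, f x * g y ≤ h ((1 / 2 : ℝ) • (x + y)) ^ 2) :
    (∫⁻ x, f x) * ∫⁻ x, g x ≤ (∫⁻ x, h x) ^ 2 := by
  set a := ⨆ x, f x with ha
  set b := ⨆ x, g x with hb
  rcases eq_or_ne a 0 with ha0 | ha0
  · have : ∀ x, f x = 0 := fun x => le_antisymm (ha0 ▸ le_iSup f x) bot_le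
    simp [this]
  rcases eq_or_ne b 0 with hb0 | hb0
  · have : ∀ x, g x = 0 := fun x => le_antisymm (hb0 ▸ le_iSup g x) bot_le
    simp [this]
  set c : ℝ≥0∞ := (a * b) ^ (1 / 2 : ℝ) with hc
  have hc2 : c ^ 2 = a * b := by
    rw [hc, ← ENNReal.rpow_natCast, ← ENNReal.rpow_mul]
    norm_num
  have hab : a * b ≠ 0 := mul_ne_zero ha0 hb0
  have hab' : a * b ≠ ∞ := ENNReal.mul_ne_top hfb hgb
  have normalized {u : ℝ → ℝ≥0∞} {s : ℝ≥0∞} (hs0 : s ≠ 0) (hst : s ≠ ∞) (hu : ∀ x, u x ≤ s)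
      (x : ℝ) : u x / s ≤ 1 :=
    ENNReal.div_le_of_le_mul (by simpa using hu x)
  have toReal_le {s : ℝ≥0∞} (hs : s ≤ 1) : s.toReal ≤ 1 := ENNReal.toReal_le_of_le_ofReal
    zero_le_one (by simpa using hs)
  have exists_lt {u : ℝ → ℝ≥0∞} {s : ℝ≥0∞} (hs : s = ⨆ x, u x) (hs0 : s ≠ 0) (hst : s ≠ ∞)
      (t : ℝ) (ht : t < 1) : ∃ x, t < (u x / s).toReal := by
    have h1 : ENNReal.ofReal t * s < ⨆ x, u x := by
      rw [← hs]
      calc ENNReal.ofReal t * s < 1 * s := by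
            refine (ENNReal.mul_lt_mul_iff_left hs0 hst).2 ?_
            simpa using ht
        _ = s := one_mul s
    obtain ⟨x, hx⟩ := lt_iSup_iff.1 h1
    have hx' : ENNReal.ofReal t < u x / s :=
      (ENNReal.lt_div_iff_mul_lt (.inl hs0) (.inl hst)).2 hx
    have hxt : u x / s ≠ ∞ := ne_top_of_le_ne_top ENNReal.one_ne_top
      (normalized hs0 hst (fun y => hs ▸ le_iSup u y) x)
    refine ⟨x, ?_⟩
    rw [← ENNReal.ofReal_toReal hxt] at hx'
    exact (ENNReal.ofReal_lt_ofReal_iff').1 hx' |>.1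
  have key := lintegral_add_lintegral_le_of_midpoint (f := fun x => (f x / a).toReal)
    (g := fun x => (g x / b).toReal) (h := fun x => (min (h x / c) 1).toReal)
    (by fun_prop) (by fun_prop) (by fun_prop)
    (fun x => ENNReal.toReal_nonneg) (fun x => ENNReal.toReal_nonneg)
    (fun x => ENNReal.toReal_nonneg)
    (fun x => toReal_le (normalized ha0 hfb (le_iSup f) x))
    (fun x => toReal_le (normalized hb0 hgb (le_iSup g) x))
    (exists_lt ha ha0 hfb) (exists_lt hb hb0 hgb) ?_
  · have e1 (x) : ENNReal.ofReal (f x / a).toReal = f x * a⁻¹ :=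
      ENNReal.ofReal_toReal (ne_top_of_le_ne_top ENNReal.one_ne_top
        (normalized ha0 hfb (le_iSup f) x))
    have e2 (x) : ENNReal.ofReal (g x / b).toReal = g x * b⁻¹ :=
      ENNReal.ofReal_toReal (ne_top_of_le_ne_top ENNReal.one_ne_top
        (normalized hb0 hgb (le_iSup g) x))
    have e3 (x) : ENNReal.ofReal (min (h x / c) 1).toReal ≤ h x * c⁻¹ :=
      ENNReal.ofReal_toReal_le.trans (min_le_left _ _)
    simp only [e1, e2] at key
    have key' := ENNReal.mul_le_sq_of_add_le (key.trans
      (mul_le_mul_right (lintegral_mono e3) 2))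
    rw [lintegral_mul_const _ hf, lintegral_mul_const _ hg, lintegral_mul_const _ hh, mul_pow,
      ← ENNReal.inv_pow, hc2] at key'
    calc (∫⁻ x, f x) * ∫⁻ x, g x
        = ((∫⁻ x, f x) * a⁻¹ * ((∫⁻ x, g x) * b⁻¹)) * (a * b) := by
          rw [show (∫⁻ x, f x) * a⁻¹ * ((∫⁻ x, g x) * b⁻¹) * (a * b) =
            (∫⁻ x, f x) * (∫⁻ x, g x) * (a⁻¹ * a) * (b⁻¹ * b) by ring,
            ENNReal.inv_mul_cancel ha0 hfb, ENNReal.inv_mul_cancel hb0 hgb, mul_one, mul_one]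
      _ ≤ (∫⁻ x, h x) ^ 2 * (a * b)⁻¹ * (a * b) := by gcongr
      _ = (∫⁻ x, h x) ^ 2 := by
          rw [mul_assoc, ENNReal.inv_mul_cancel hab hab', mul_one]
  · intro t ht x y hx hy
    refine (ENNReal.ofReal_lt_iff_lt_toReal ht.le (ne_top_of_le_ne_top ENNReal.one_ne_top
      (min_le_right _ _))).1 (lt_min ?_ ?_)
    · have hx' := (ENNReal.ofReal_lt_iff_lt_toReal ht.le (ne_top_of_le_ne_top ENNReal.one_ne_top
        (normalized ha0 hfb (le_iSup f) x))).2 hx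
      have hy' := (ENNReal.ofReal_lt_iff_lt_toReal ht.le (ne_top_of_le_ne_top ENNReal.one_ne_top
        (normalized hb0 hgb (le_iSup g) y))).2 hy
      refine lt_of_pow_lt_pow_left' 2 ?_
      calc ENNReal.ofReal t ^ 2 = ENNReal.ofReal t * ENNReal.ofReal t := sq _
        _ < (f x / a) * (g y / b) := ENNReal.mul_lt_mul hx' hy'
        _ = f x * g y * (a * b)⁻¹ := by
          rw [ENNReal.mul_inv (.inl ha0) (.inl hfb), div_eq_mul_inv, div_eq_mul_inv]; ring
        _ ≤ h ((1 / 2 : ℝ) • (x + y)) ^ 2 * (a * b)⁻¹ := by gcongr; exact H x y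
        _ = (h ((1 / 2 : ℝ) • (x + y)) / c) ^ 2 := by
          rw [div_eq_mul_inv (h _), mul_pow, ← ENNReal.inv_pow, hc2]
    · have := hx.trans_le (toReal_le (normalized ha0 hfb (le_iSup f) x))
      simpa using this

/-- The midpoint form of the Prékopa-Leindler inequality on the real line. -/
theorem prekopa_leindler_real {f g h : ℝ → ℝ≥0∞}
    (hf : Measurable f) (hg : Measurable g) (hh : Measurable h)
    (H : ∀ x y, f x * g y ≤ h ((1 / 2 : ℝ) • (x + y)) ^ 2) :
    (∫⁻ x, f x) * ∫⁻ x, g x ≤ (∫⁻ x, h x) ^ 2 := by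
  have trunc {u : ℝ → ℝ≥0∞} (hu : Measurable u) :
      ∫⁻ x, u x = ⨆ n : ℕ, ∫⁻ x, min (u x) n := by
    rw [← lintegral_iSup (fun n => hu.min measurable_const)
      fun n m hnm x => min_le_min_left _ (by exact_mod_cast hnm)]
    refine lintegral_congr fun x => ?_
    rw [← inf_iSup_eq, ENNReal.iSup_natCast]
    simp
  have bdd (u : ℝ → ℝ≥0∞) (n : ℕ) : (⨆ x, min (u x) n) ≠ ∞ :=
    ne_top_of_le_ne_top (ENNReal.natCast_ne_top n) (iSup_le fun x => min_le_right _ _)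
  rw [trunc hf, trunc hg, ENNReal.iSup_mul]
  refine iSup_le fun n => ?_
  rw [ENNReal.mul_iSup]
  refine iSup_le fun m => ?_
  exact prekopa_leindler_real_of_bounded (hf.min measurable_const) (hg.min measurable_const) hh
    (bdd f n) (bdd g m) fun x y =>
      (mul_le_mul' (min_le_left _ _) (min_le_left _ _)).trans (H x y)

/-- The midpoint form of the Prékopa-Leindler inequality on `ℝⁿ`. -/
theorem prekopa_leindler_pi (n : ℕ) {f g h : (Fin n → ℝ) → ℝ≥0∞}
    (hf : Measurable f) (hg : Measurable g) (hh : Measurable h)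
    (H : ∀ x y, f x * g y ≤ h ((1 / 2 : ℝ) • (x + y)) ^ 2) :
    (∫⁻ x, f x) * ∫⁻ x, g x ≤ (∫⁻ x, h x) ^ 2 := by
  induction n with
  | zero =>
    have : ∀ u : (Fin 0 → ℝ) → ℝ≥0∞, ∫⁻ x, u x = u 0 := by
      intro u
      rw [volume_pi, Measure.pi_of_empty _ 0, lintegral_dirac]
    rw [this, this, this]
    simpa using H 0 0
  | succ n ih =>
    set e := MeasurableEquiv.piFinSuccAbove (fun _ : Fin (n + 1) => ℝ) 0
    have he := (volume_preserving_piFinSuccAbove (fun _ : Fin (n + 1) => ℝ) 0).symm e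
    have split {u : (Fin (n + 1) → ℝ) → ℝ≥0∞} (hu : Measurable u) :
        ∫⁻ x, u x = ∫⁻ s, ∫⁻ y, u (e.symm (s, y)) := by
      rw [← he.lintegral_comp hu]
      exact lintegral_prod _ (hu.comp e.symm.measurable).aemeasurable
    have meas {u : (Fin (n + 1) → ℝ) → ℝ≥0∞} (hu : Measurable u) :
        Measurable fun s => ∫⁻ y, u (e.symm (s, y)) :=
      (hu.comp e.symm.measurable).lintegral_prod_right'
    have slice {u : (Fin (n + 1) → ℝ) → ℝ≥0∞} (hu : Measurable u) (s : ℝ) :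
        Measurable fun y => u (e.symm (s, y)) :=
      hu.comp (e.symm.measurable.comp measurable_prodMk_left)
    rw [split hf, split hg, split hh]
    refine prekopa_leindler_real (meas hf) (meas hg) (meas hh) fun s t => ?_
    refine ih (slice hf s) (slice hg t) (slice hh _) fun x y => ?_
    refine (H _ _).trans_eq ?_
    congr 2
    ext i
    refine Fin.cases ?_ (fun j => ?_) i <;> simp [e, mul_add]

/-- The midpoint form of the Prékopa-Leindler inequality on Euclidean space. -/
theorem prekopa_leindler {n : ℕ} {f g h : EuclideanSpace ℝ (Fin n) → ℝ≥0∞}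
    (hf : Measurable f) (hg : Measurable g) (hh : Measurable h)
    (H : ∀ x y, f x * g y ≤ h ((1 / 2 : ℝ) • (x + y)) ^ 2) :
    (∫⁻ x, f x) * ∫⁻ x, g x ≤ (∫⁻ x, h x) ^ 2 := by
  have hp := PiLp.volume_preserving_toLp (Fin n)
  rw [← hp.lintegral_comp hf, ← hp.lintegral_comp hg, ← hp.lintegral_comp hh]
  refine prekopa_leindler_pi n (hf.comp hp.measurable) (hg.comp hp.measurable)
    (hh.comp hp.measurable) fun x y => ?_
  simpa using H (WithLp.toLp 2 x) (WithLp.toLp 2 y)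

theorem midpoint_strong_convexity {E : Type*} [NormedAddCommGroup E] [NormedSpace ℝ E]
    {Φ : E → ℝ} (hΦ : ContDiff ℝ 2 Φ) {k : ℝ}
    (hconv : ∀ x u : E, k * ‖u‖ ^ 2 ≤ iteratedFDeriv ℝ 2 Φ x ![u, u]) (x y : E) :
    2 * Φ ((1 / 2 : ℝ) • (x + y)) + k / 4 * ‖x - y‖ ^ 2 ≤ Φ x + Φ y := by
  set v := y - x with hv
  set q : ℝ := k * ‖v‖ ^ 2 with hq
  have line (t : ℝ) : HasDerivAt (fun t : ℝ => x + t • v) v t := by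
    simpa using ((hasDerivAt_id t).smul_const v).const_add x
  have h1 (t : ℝ) : HasDerivAt (fun t : ℝ => Φ (x + t • v) - q / 2 * t ^ 2)
      (fderiv ℝ Φ (x + t • v) v - q * t) t := by
    have hd := ((hΦ.differentiable (by norm_num)) (x + t • v)).hasFDerivAt
    refine ((hd.comp_hasDerivAt t (line t)).sub
      ((hasDerivAt_pow 2 t).const_mul (q / 2))).congr_deriv ?_
    norm_num
    ring
  have h2 (t : ℝ) : HasDerivAt (fun t : ℝ => fderiv ℝ Φ (x + t • v) v - q * t)
      (fderiv ℝ (fderiv ℝ Φ) (x + t • v) v v - q) t := by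
    have hd := ((hΦ.fderiv_right (m := 1) (by norm_num)).differentiable (by norm_num)
      (x + t • v)).hasFDerivAt
    have hd' : HasFDerivAt (fun z => fderiv ℝ Φ z v)
        ((ContinuousLinearMap.apply ℝ ℝ v).comp (fderiv ℝ (fderiv ℝ Φ) (x + t • v)))
        (x + t • v) := (ContinuousLinearMap.apply ℝ ℝ v).hasFDerivAt.comp _ hd
    have hc := hd'.comp_hasDerivAt t (line t)
    have hq : HasDerivAt (fun t => q * t) q t := by
      simpa using (hasDerivAt_id t).const_mul q
    exact hc.sub hq
  have e1 : deriv (fun t : ℝ => Φ (x + t • v) - q / 2 * t ^ 2) =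
      fun t => fderiv ℝ Φ (x + t • v) v - q * t := funext fun t => (h1 t).deriv
  have hc := convexOn_univ_of_deriv2_nonneg (fun t => (h1 t).differentiableAt)
    (by rw [e1]; exact fun t => (h2 t).differentiableAt) (fun t => by
      rw [Function.iterate_succ, Function.iterate_one, Function.comp_apply, e1, (h2 t).deriv]
      have := hconv (x + t • v) v
      rw [iteratedFDeriv_two_apply] at this
      simpa [hq] using this)
  have h := hc.2 (Set.mem_univ (0 : ℝ)) (Set.mem_univ (1 : ℝ))
    (show (0 : ℝ) ≤ 1 / 2 by norm_num) (show (0 : ℝ) ≤ 1 / 2 by norm_num) (by norm_num)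
  have e2 : x + (1 / 2 : ℝ) • v = (1 / 2 : ℝ) • (x + y) := by rw [hv]; module
  simp only [smul_eq_mul, mul_zero, mul_one, zero_add, e2, zero_smul, one_smul, add_zero] at h
  rw [norm_sub_rev x y, ← hv]
  have e3 : x + v = y := by rw [hv]; abel
  rw [e3] at h
  rw [hq] at h
  linarith

section Subgradient

variable {E : Type*} [NormedAddCommGroup E] [InnerProductSpace ℝ E]

theorem le_quadratic_of_subgradient_of_midpoint {G : E → ℝ} {p : E → E} {L : ℝ}
    (hsub : ∀ x y, G x + inner ℝ (p x) (y - x) ≤ G y)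
    (hmid : ∀ x y, G x + G y ≤ 2 * G ((1 / 2 : ℝ) • (x + y)) + L / 4 * ‖x - y‖ ^ 2) (x v : E) :
    G (x + v) ≤ G x + inner ℝ (p x) v + L / 2 * ‖v‖ ^ 2 := by
  set ψ : E → ℝ := fun v => G (x + v) - G x - inner ℝ (p x) v - L / 2 * ‖v‖ ^ 2 with hψ
  have upper (v : E) : ψ v ≤ L / 2 * ‖v‖ ^ 2 := by
    have h1 := hsub x (x - v)
    have h2 := hmid (x + v) (x - v)
    rw [show (1 / 2 : ℝ) • (x + v + (x - v)) = x by module,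
      show x + v - (x - v) = (2 : ℝ) • v by module, norm_smul, mul_pow] at h2
    rw [show x - v - x = -v by abel, inner_neg_right] at h1
    norm_num at h2
    simp only [hψ]
    linarith
  have half (v : E) : ψ v ≤ 2 * ψ ((1 / 2 : ℝ) • v) := by
    have h2 := hmid x (x + v)
    rw [show (1 / 2 : ℝ) • (x + (x + v)) = x + (1 / 2 : ℝ) • v by module,
      show x - (x + v) = -v by abel, norm_neg] at h2
    simp only [hψ, inner_smul_right, norm_smul, mul_pow]
    norm_num at h2 ⊢
    linarith
  have iter (n : ℕ) : ∀ v, ψ v ≤ 2 ^ n * ψ ((1 / 2 : ℝ) ^ n • v) := by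
    induction n with
    | zero => simp
    | succ n ih =>
      intro v
      have h := half ((1 / 2 : ℝ) ^ n • v)
      rw [smul_smul, ← pow_succ'] at h
      calc ψ v ≤ 2 ^ n * ψ ((1 / 2 : ℝ) ^ n • v) := ih v
        _ ≤ 2 ^ n * (2 * ψ ((1 / 2 : ℝ) ^ (n + 1) • v)) := by gcongr
        _ = 2 ^ (n + 1) * ψ ((1 / 2 : ℝ) ^ (n + 1) • v) := by ring
  have bound (n : ℕ) : ψ v ≤ (1 / 2 : ℝ) ^ n * (L / 2 * ‖v‖ ^ 2) := by
    refine (iter n v).trans ((mul_le_mul_of_nonneg_left (upper _) (by positivity)).trans_eq ?_)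
    rw [norm_smul, mul_pow, Real.norm_of_nonneg (by positivity)]
    have : (2 : ℝ) ^ n * (1 / 2) ^ n = 1 := by rw [← mul_pow]; norm_num
    linear_combination (1 / 2 : ℝ) ^ n * (L / 2 * ‖v‖ ^ 2) * this
  have lim := (tendsto_pow_atTop_nhds_zero_of_lt_one (r := (1 / 2 : ℝ)) (by norm_num)
    (by norm_num)).mul_const (L / 2 * ‖v‖ ^ 2)
  have := ge_of_tendsto' lim bound
  simp only [hψ, zero_mul] at this
  linarith

/-- A subgradient field of a function which is convex and satisfies the midpoint upper bound of an
`L`-smooth function is `L`-Lipschitz. -/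
theorem norm_subgradient_sub_le {G : E → ℝ} {p : E → E} {L : ℝ} (hL : 0 < L)
    (hsub : ∀ x y, G x + inner ℝ (p x) (y - x) ≤ G y)
    (hmid : ∀ x y, G x + G y ≤ 2 * G ((1 / 2 : ℝ) • (x + y)) + L / 4 * ‖x - y‖ ^ 2) (x y : E) :
    ‖p x - p y‖ ≤ L * ‖x - y‖ := by
  have coercive (x y : E) :
      G x + inner ℝ (p x) (y - x) + 1 / (2 * L) * ‖p x - p y‖ ^ 2 ≤ G y := by
    set d := p x - p y with hd
    have h1 := hsub x (y + (1 / L) • d)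
    have h2 := le_quadratic_of_subgradient_of_midpoint hsub hmid y ((1 / L) • d)
    have h3 : inner ℝ (p x) d - inner ℝ (p y) d = ‖d‖ ^ 2 := by
      rw [← inner_sub_left, ← hd, real_inner_self_eq_norm_sq]
    rw [show y + (1 / L) • d - x = (y - x) + (1 / L) • d by abel, inner_add_right,
      inner_smul_right] at h1
    rw [inner_smul_right, norm_smul, mul_pow, Real.norm_eq_abs, sq_abs] at h2
    have h4 : L / 2 * ((1 / L) ^ 2 * ‖d‖ ^ 2) = 1 / (2 * L) * ‖d‖ ^ 2 := by field_simp
    have h5 : 1 / L * inner ℝ (p x) d - 1 / L * inner ℝ (p y) d = 2 * (1 / (2 * L) * ‖d‖ ^ 2) := by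
      rw [← mul_sub, h3]; field_simp
    linarith
  have h1 := coercive x y
  have h2 := coercive y x
  rw [norm_sub_rev (p y) (p x)] at h2
  have h3 : inner ℝ (p x) (y - x) + inner ℝ (p y) (x - y) = - inner ℝ (p x - p y) (x - y) := by
    rw [← neg_sub x y, inner_neg_right, inner_sub_left]; ring
  have h4 := real_inner_le_norm (p x - p y) (x - y)
  have h5 : 1 / L * ‖p x - p y‖ ^ 2 ≤ ‖p x - p y‖ * ‖x - y‖ := by
    have : 1 / L * ‖p x - p y‖ ^ 2 = 2 * (1 / (2 * L) * ‖p x - p y‖ ^ 2) := by field_simp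
    linarith
  rcases (norm_nonneg (p x - p y)).eq_or_lt with h0 | h0
  · rw [← h0]; positivity
  · rw [one_div, inv_mul_le_iff₀ hL] at h5
    nlinarith

end Subgradient

section Posterior

variable {N : ℕ}

/-- The unnormalised posterior density at `z` given the observation `x`. -/
noncomputable def posteriorWeight (Φ : EuclideanSpace ℝ (Fin N) → ℝ)
    (a : EuclideanSpace ℝ (Fin N)) (β γ : ℝ) (x z : EuclideanSpace ℝ (Fin N)) : ℝ :=
  Real.exp (-(‖a + β • z - x‖ ^ 2 / (2 * γ ^ 2)) - Φ z)

variable {Φ : EuclideanSpace ℝ (Fin N) → ℝ} {a : EuclideanSpace ℝ (Fin N)} {β γ : ℝ}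

theorem posteriorWeight_pos (x z : EuclideanSpace ℝ (Fin N)) :
    0 < posteriorWeight Φ a β γ x z := Real.exp_pos _

theorem posteriorWeight_eq_mul_exp (x y z : EuclideanSpace ℝ (Fin N)) :
    posteriorWeight Φ a β γ y z = posteriorWeight Φ a β γ x z *
      Real.exp ((inner ℝ (a + β • z - x) (y - x) - ‖y - x‖ ^ 2 / 2) / γ ^ 2) := by
  rw [posteriorWeight, posteriorWeight, ← Real.exp_add]
  congr 1
  have h : ‖a + β • z - y‖ ^ 2 =
      ‖a + β • z - x‖ ^ 2 - 2 * inner ℝ (a + β • z - x) (y - x) + ‖y - x‖ ^ 2 := by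
    rw [← norm_sub_sq_real]; congr 2; abel
  rw [h]
  ring

theorem integrable_posteriorWeight_mul_inner (hβ : 0 < β) (hγ : 0 < γ) (hΦ : Continuous Φ)
    (hfin : ∀ x, Integrable (posteriorWeight Φ a β γ x)) (x v : EuclideanSpace ℝ (Fin N)) :
    Integrable fun z => posteriorWeight Φ a β γ x z * inner ℝ z v := by
  have hcont : Continuous (posteriorWeight Φ a β γ x) := by
    unfold posteriorWeight; fun_prop
  set s : EuclideanSpace ℝ (Fin N) → ℝ := fun z => inner ℝ (a + β • z - x) v / γ ^ 2 with hs
  have hscont : Continuous s := by fun_prop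
  set C : ℝ := Real.exp (‖v‖ ^ 2 / 2 / γ ^ 2) with hC
  have hplus (z) : posteriorWeight Φ a β γ x z * Real.exp (s z) =
      C * posteriorWeight Φ a β γ (x + v) z := by
    rw [posteriorWeight_eq_mul_exp x (x + v) z, add_sub_cancel_left, mul_left_comm, hC,
      ← Real.exp_add]
    congr 2
    simp only [hs]; ring
  have hminus (z) : posteriorWeight Φ a β γ x z * Real.exp (-s z) =
      C * posteriorWeight Φ a β γ (x - v) z := by
    rw [posteriorWeight_eq_mul_exp x (x - v) z, sub_sub_cancel_left, inner_neg_right, norm_neg,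
      mul_left_comm, hC, ← Real.exp_add]
    congr 2
    simp only [hs]; ring
  have hint : Integrable fun z => posteriorWeight Φ a β γ x z * s z := by
    refine (((hfin (x + v)).const_mul C).add ((hfin (x - v)).const_mul C)).mono'
      (hcont.mul hscont).aestronglyMeasurable (.of_forall fun z => ?_)
    rw [Pi.add_apply, ← hplus, ← hminus, ← mul_add, norm_mul,
      Real.norm_of_nonneg (posteriorWeight_pos x z).le]
    refine mul_le_mul_of_nonneg_left ?_ (posteriorWeight_pos x z).le
    rw [Real.norm_eq_abs]
    refine abs_le'.2 ⟨?_, ?_⟩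
    · linarith [Real.add_one_le_exp (s z), Real.exp_pos (-s z)]
    · linarith [Real.add_one_le_exp (-s z), Real.exp_pos (s z)]
  refine ((hint.const_mul (γ ^ 2 / β)).sub
    ((hfin x).const_mul (inner ℝ (a - x) v / β))).congr (.of_forall fun z => ?_)
  have e : s z = (inner ℝ (a - x) v + β * inner ℝ z v) / γ ^ 2 := by
    simp only [hs]
    rw [← real_inner_smul_left, ← inner_add_left]
    congr 3; abel
  simp only [Pi.sub_apply, e]
  field_simp
  ring

theorem integrable_posteriorWeight_smul (hβ : 0 < β) (hγ : 0 < γ) (hΦ : Continuous Φ)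
    (hfin : ∀ x, Integrable (posteriorWeight Φ a β γ x)) (x : EuclideanSpace ℝ (Fin N)) :
    Integrable fun z => posteriorWeight Φ a β γ x z • z := by
  have hcont : Continuous (posteriorWeight Φ a β γ x) := by
    unfold posteriorWeight; fun_prop
  have h (i : Fin N) := (integrable_posteriorWeight_mul_inner hβ hγ hΦ hfin x
    (EuclideanSpace.basisFun (Fin N) ℝ i)).norm
  refine (integrable_finsetSum Finset.univ fun i _ => h i).mono'
    (hcont.smul continuous_id).aestronglyMeasurable (.of_forall fun z => ?_)
  simp only [norm_mul, norm_smul, ← Finset.mul_sum]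
  refine mul_le_mul_of_nonneg_left ?_ (norm_nonneg _)
  conv_lhs => rw [← (EuclideanSpace.basisFun (Fin N) ℝ).sum_repr' z]
  refine (norm_sum_le _ _).trans_eq (Finset.sum_congr rfl fun i _ => ?_)
  rw [norm_smul, OrthonormalBasis.norm_eq_one, mul_one, real_inner_comm]

theorem posteriorWeight_mul_le {k : ℝ} (hk : 0 < k) (hβ : 0 < β) (hγ : 0 < γ)
    (hΦ : ∀ x y, 2 * Φ ((1 / 2 : ℝ) • (x + y)) + k / 4 * ‖x - y‖ ^ 2 ≤ Φ x + Φ y)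
    (x y z w : EuclideanSpace ℝ (Fin N)) :
    posteriorWeight Φ a β γ x z * posteriorWeight Φ a β γ y w ≤
      (Real.exp (-(k / (8 * (β ^ 2 + k * γ ^ 2)) * ‖x - y‖ ^ 2)) *
        posteriorWeight Φ a β γ ((1 / 2 : ℝ) • (x + y)) ((1 / 2 : ℝ) • (z + w))) ^ 2 := by
  simp only [posteriorWeight]
  rw [← Real.exp_add, ← Real.exp_add, ← Real.exp_nat_mul]
  refine Real.exp_le_exp.2 ?_
  set A := a + β • z - x with hA
  set B := a + β • w - y with hB
  have hM : a + β • (1 / 2 : ℝ) • (z + w) - (1 / 2 : ℝ) • (x + y) = (1 / 2 : ℝ) • (A + B) := by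
    rw [hA, hB]; module
  have hpar := parallelogram_law_with_norm ℝ A B
  have hζ := hΦ z w
  rw [hM, norm_smul, mul_pow]
  have htri : ‖x - y‖ ≤ ‖A - B‖ + β * ‖z - w‖ := by
    rw [show x - y = β • (z - w) - (A - B) by rw [hA, hB]; module, add_comm]
    refine (norm_sub_le _ _).trans_eq ?_
    rw [norm_smul, Real.norm_of_nonneg hβ.le]
  set P := ‖A - B‖
  set Q := ‖z - w‖
  have hD : 0 < β ^ 2 + k * γ ^ 2 := by positivity
  have hkey : k / (β ^ 2 + k * γ ^ 2) * ‖x - y‖ ^ 2 ≤ P ^ 2 / γ ^ 2 + k * Q ^ 2 := by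
    calc k / (β ^ 2 + k * γ ^ 2) * ‖x - y‖ ^ 2
        ≤ k / (β ^ 2 + k * γ ^ 2) * (P + β * Q) ^ 2 := by gcongr
      _ ≤ P ^ 2 / γ ^ 2 + k * Q ^ 2 := by
        have : P ^ 2 / γ ^ 2 + k * Q ^ 2 - k / (β ^ 2 + k * γ ^ 2) * (P + β * Q) ^ 2 =
            (β * P - k * γ ^ 2 * Q) ^ 2 / (γ ^ 2 * (β ^ 2 + k * γ ^ 2)) := by
          field_simp; ring
        have h0 : 0 ≤ (β * P - k * γ ^ 2 * Q) ^ 2 / (γ ^ 2 * (β ^ 2 + k * γ ^ 2)) := by positivity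
        linarith
  have hs : ‖A + B‖ ^ 2 = 2 * (‖A‖ ^ 2 + ‖B‖ ^ 2) - P ^ 2 := by linarith
  rw [hs]
  have e1 : k / (8 * (β ^ 2 + k * γ ^ 2)) * ‖x - y‖ ^ 2 =
      (k / (β ^ 2 + k * γ ^ 2) * ‖x - y‖ ^ 2) / 8 := by field_simp
  rw [e1]
  have e2 : ‖(1 / 2 : ℝ)‖ ^ 2 * (2 * (‖A‖ ^ 2 + ‖B‖ ^ 2) - P ^ 2) / (2 * γ ^ 2) =
      ‖A‖ ^ 2 / (2 * γ ^ 2) / 2 + ‖B‖ ^ 2 / (2 * γ ^ 2) / 2 - (P ^ 2 / γ ^ 2) / 8 := by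
    norm_num; field_simp; ring
  rw [e2]
  push_cast
  linarith

theorem integral_posteriorWeight_mul_le {k : ℝ} (hk : 0 < k) (hβ : 0 < β) (hγ : 0 < γ)
    (hcont : Continuous Φ)
    (hΦ : ∀ x y, 2 * Φ ((1 / 2 : ℝ) • (x + y)) + k / 4 * ‖x - y‖ ^ 2 ≤ Φ x + Φ y)
    (hfin : ∀ x, Integrable (posteriorWeight Φ a β γ x)) (x y : EuclideanSpace ℝ (Fin N)) :
    (∫ z, posteriorWeight Φ a β γ x z) * ∫ z, posteriorWeight Φ a β γ y z ≤
      (Real.exp (-(k / (8 * (β ^ 2 + k * γ ^ 2)) * ‖x - y‖ ^ 2)) *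
        ∫ z, posteriorWeight Φ a β γ ((1 / 2 : ℝ) • (x + y)) z) ^ 2 := by
  set c := Real.exp (-(k / (8 * (β ^ 2 + k * γ ^ 2)) * ‖x - y‖ ^ 2)) with hc
  have hc0 : 0 < c := Real.exp_pos _
  have hW (x) : Measurable (posteriorWeight Φ a β γ x) := by
    refine Continuous.measurable ?_
    unfold posteriorWeight; fun_prop
  have h := prekopa_leindler (hW x).ennreal_ofReal (hW y).ennreal_ofReal
    (((hW ((1 / 2 : ℝ) • (x + y))).const_mul c).ennreal_ofReal) fun z w => by
      rw [← ENNReal.ofReal_mul (posteriorWeight_pos x z).le,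
        ← ENNReal.ofReal_pow (mul_pos hc0 (posteriorWeight_pos _ _)).le]
      exact ENNReal.ofReal_le_ofReal (posteriorWeight_mul_le hk hβ hγ hΦ x y z w)
  rw [← ofReal_integral_eq_lintegral_ofReal (hfin x)
      (.of_forall fun z => (posteriorWeight_pos x z).le),
    ← ofReal_integral_eq_lintegral_ofReal (hfin y)
      (.of_forall fun z => (posteriorWeight_pos y z).le),
    ← ofReal_integral_eq_lintegral_ofReal ((hfin _).const_mul c)
      (.of_forall fun z => (mul_pos hc0 (posteriorWeight_pos _ z)).le),
    ← ENNReal.ofReal_mul (integral_nonneg fun z => (posteriorWeight_pos x z).le),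
    ← ENNReal.ofReal_pow (integral_nonneg fun z => (mul_pos hc0 (posteriorWeight_pos _ z)).le),
    ENNReal.ofReal_le_ofReal_iff (by positivity), integral_const_mul] at h
  exact h

theorem integral_posteriorWeight_pos (hfin : ∀ x, Integrable (posteriorWeight Φ a β γ x))
    (x : EuclideanSpace ℝ (Fin N)) : 0 < ∫ z, posteriorWeight Φ a β γ x z :=
  integral_exp_pos (hfin x)

/-- Jensen's inequality for the log-partition function. -/
theorem integral_posteriorWeight_mul_exp_le (hβ : 0 < β) (hγ : 0 < γ) (hcont : Continuous Φ)
    (hfin : ∀ x, Integrable (posteriorWeight Φ a β γ x)) {x m : EuclideanSpace ℝ (Fin N)}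
    (hm : m = (∫ z, posteriorWeight Φ a β γ x z)⁻¹ • ∫ z, posteriorWeight Φ a β γ x z • z)
    (y : EuclideanSpace ℝ (Fin N)) :
    (∫ z, posteriorWeight Φ a β γ x z) *
        Real.exp ((inner ℝ (a + β • m - x) (y - x) - ‖y - x‖ ^ 2 / 2) / γ ^ 2) ≤
      ∫ z, posteriorWeight Φ a β γ y z := by
  set W := posteriorWeight Φ a β γ x with hW
  set Z := ∫ z, W z with hZ
  have hZ0 : 0 < Z := integral_posteriorWeight_pos hfin x
  set c := (inner ℝ (a + β • m - x) (y - x) - ‖y - x‖ ^ 2 / 2) / γ ^ 2 with hc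
  set v := y - x
  have hWv : Integrable fun z => W z * inner ℝ z v :=
    integrable_posteriorWeight_mul_inner hβ hγ hcont hfin x v
  have hlin : ∫ z, W z * inner ℝ z v = Z * inner ℝ m v := by
    have h1 := integral_inner (𝕜 := ℝ) (integrable_posteriorWeight_smul hβ hγ hcont hfin x) v
    have h2 : ∫ z, W z • z = Z • m := by
      rw [hm, smul_smul, mul_inv_cancel₀ hZ0.ne', one_smul]
    rw [h2, inner_smul_right, real_inner_comm] at h1
    rw [← h1]
    refine integral_congr_ae (.of_forall fun z => ?_)
    simp only [inner_smul_right, ← hW]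
    rw [real_inner_comm]
  have hzero : Integrable fun z => W z * inner ℝ z v - inner ℝ m v * W z :=
    hWv.sub ((hfin x).const_mul _)
  have hle : ∫ z, Real.exp c * (W z + β / γ ^ 2 * (W z * inner ℝ z v - inner ℝ m v * W z)) ≤
      ∫ z, posteriorWeight Φ a β γ y z := by
    refine integral_mono ((((hfin x)).add (hzero.const_mul _)).const_mul _) (hfin y) fun z => ?_
    simp only
    rw [posteriorWeight_eq_mul_exp x y z, ← hW]
    have e : (inner ℝ (a + β • z - x) v - ‖v‖ ^ 2 / 2) / γ ^ 2 =
        c + β / γ ^ 2 * (inner ℝ z v - inner ℝ m v) := by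
      simp only [hc, inner_sub_left, inner_add_left, real_inner_smul_left]
      ring
    rw [e, Real.exp_add]
    have h1 := Real.add_one_le_exp (β / γ ^ 2 * (inner ℝ z v - inner ℝ m v))
    have h2 : 0 ≤ W z * Real.exp c := (mul_pos (posteriorWeight_pos x z) (Real.exp_pos c)).le
    nlinarith [mul_le_mul_of_nonneg_left h1 h2]
  refine le_trans (le_of_eq ?_) hle
  rw [integral_const_mul, integral_add (hfin x) (hzero.const_mul _), integral_const_mul,
    integral_sub hWv ((hfin x).const_mul _), integral_const_mul, hlin]
  ring

end Posterior

/-- Lipschitz continuity of the posterior mean under a strongly log-concave prior: for a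
`k`-strongly convex, twice continuously differentiable potential `Φ` on `ℝᴺ`, Gaussian
likelihood with signal scale `β` and noise scale `γ`, the posterior mean
`m(x) = Z(x)⁻¹·∫ x₁·exp(−‖a + β·x₁ − x‖²/(2γ²) − Φ(x₁)) dx₁` is Lipschitz with constant
`β/(β² + k·γ²)`. -/
theorem posterior_mean_lipschitz_of_strongly_log_concave
    (N : ℕ) (hN : 1 ≤ N)
    (Φ : EuclideanSpace ℝ (Fin N) → ℝ) (hΦ : ContDiff ℝ 2 Φ)
    (k : ℝ) (hk : 0 < k)
    (hconv : ∀ x u : EuclideanSpace ℝ (Fin N),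
      k * ‖u‖ ^ 2 ≤ iteratedFDeriv ℝ 2 Φ x ![u, u])
    (a : EuclideanSpace ℝ (Fin N)) (β γ : ℝ) (hβ : 0 < β) (hγ : 0 < γ)
    (Z : EuclideanSpace ℝ (Fin N) → ℝ)
    (hZfin : ∀ x : EuclideanSpace ℝ (Fin N),
      Integrable (fun x₁ => Real.exp (-(‖a + β • x₁ - x‖ ^ 2 / (2 * γ ^ 2)) - Φ x₁)))
    (hZ : ∀ x, Z x = ∫ x₁, Real.exp (-(‖a + β • x₁ - x‖ ^ 2 / (2 * γ ^ 2)) - Φ x₁))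
    (m : EuclideanSpace ℝ (Fin N) → EuclideanSpace ℝ (Fin N))
    (hm : ∀ x, m x = (Z x)⁻¹ •
      ∫ x₁, Real.exp (-(‖a + β • x₁ - x‖ ^ 2 / (2 * γ ^ 2)) - Φ x₁) • x₁) :
    ∀ x y : EuclideanSpace ℝ (Fin N),
      ‖m x - m y‖ ≤ (β / (β ^ 2 + k * γ ^ 2)) * ‖x - y‖ := by
  have hcont : Continuous Φ := hΦ.continuous
  have hmidΦ := midpoint_strong_convexity hΦ hconv
  have hfin : ∀ x, Integrable (posteriorWeight Φ a β γ x) := hZfin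
  have hZ' : ∀ x, Z x = ∫ z, posteriorWeight Φ a β γ x z := hZ
  have hZ0 (x) : 0 < Z x := hZ' x ▸ integral_posteriorWeight_pos hfin x
  have hD : 0 < β ^ 2 + k * γ ^ 2 := by positivity
  set G : EuclideanSpace ℝ (Fin N) → ℝ := fun x =>
    Real.log (Z x) + (‖x‖ ^ 2 / 2 - inner ℝ a x) / γ ^ 2 with hG
  have hsub (x y) : G x + inner ℝ ((β / γ ^ 2) • m x) (y - x) ≤ G y := by
    have h := integral_posteriorWeight_mul_exp_le hβ hγ hcont hfin
      (x := x) (m := m x) (by rw [hm, hZ']; rfl) y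
    rw [← hZ', ← hZ'] at h
    have hlog := Real.log_le_log (mul_pos (hZ0 x) (Real.exp_pos _)) h
    rw [Real.log_mul (hZ0 x).ne' (Real.exp_pos _).ne', Real.log_exp] at hlog
    have e : (inner ℝ (a + β • m x - x) (y - x) - ‖y - x‖ ^ 2 / 2) / γ ^ 2 =
        inner ℝ ((β / γ ^ 2) • m x) (y - x) + (‖x‖ ^ 2 / 2 - inner ℝ a x) / γ ^ 2
          - (‖y‖ ^ 2 / 2 - inner ℝ a y) / γ ^ 2 := by
      rw [norm_sub_sq_real]
      simp only [inner_sub_left, inner_add_left, inner_sub_right, real_inner_smul_left,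
        real_inner_self_eq_norm_sq]
      rw [real_inner_comm y x]
      ring
    simp only [hG]
    linarith
  have hmid (x y) : G x + G y ≤ 2 * G ((1 / 2 : ℝ) • (x + y)) +
      (β ^ 2 / (γ ^ 2 * (β ^ 2 + k * γ ^ 2))) / 4 * ‖x - y‖ ^ 2 := by
    have h := integral_posteriorWeight_mul_le hk hβ hγ hcont hmidΦ hfin x y
    simp only [← hZ'] at h
    have hlog := Real.log_le_log (mul_pos (hZ0 x) (hZ0 y)) h
    rw [Real.log_mul (hZ0 x).ne' (hZ0 y).ne', Real.log_pow,
      Real.log_mul (Real.exp_pos _).ne' (hZ0 _).ne', Real.log_exp] at hlog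
    have hpar := parallelogram_law_with_norm ℝ x y
    have hs : ‖x + y‖ ^ 2 = 2 * (‖x‖ ^ 2 + ‖y‖ ^ 2) - ‖x - y‖ ^ 2 := by linarith
    have e : (‖x‖ ^ 2 / 2 - inner ℝ a x) / γ ^ 2 + (‖y‖ ^ 2 / 2 - inner ℝ a y) / γ ^ 2 =
        2 * ((‖(1 / 2 : ℝ) • (x + y)‖ ^ 2 / 2 - inner ℝ a ((1 / 2 : ℝ) • (x + y))) / γ ^ 2) +
          (β ^ 2 / (γ ^ 2 * (β ^ 2 + k * γ ^ 2))) / 4 * ‖x - y‖ ^ 2 +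
          2 * (k / (8 * (β ^ 2 + k * γ ^ 2)) * ‖x - y‖ ^ 2) := by
      rw [norm_smul, mul_pow, hs, inner_smul_right, inner_add_right]
      norm_num
      field_simp
      ring
    simp only [hG]
    push_cast at hlog
    linarith
  intro x y
  have h := norm_subgradient_sub_le (by positivity) hsub hmid x y
  rw [← smul_sub, norm_smul, Real.norm_of_nonneg (by positivity)] at h
  calc ‖m x - m y‖ = γ ^ 2 / β * (β / γ ^ 2 * ‖m x - m y‖) := by field_simp
    _ ≤ γ ^ 2 / β * (β ^ 2 / (γ ^ 2 * (β ^ 2 + k * γ ^ 2)) * ‖x - y‖) := by gcongr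
    _ = β / (β ^ 2 + k * γ ^ 2) * ‖x - y‖ := by field_simp
end
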